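/- arXiv:1712.09117 — 4 statements merged into one kernel-verified Lean document; each statement's English description precedes it below -/
import Mathlib

section
/- Let W be an n×n real orthogonal matrix (WᵀW = I_n), x ∈ ℝⁿ, and let ε be a random vector in ℝⁿ with independent coordinates each distributed N(0,σ²), σ > 0. Then the orthogonal ideal risk satisfies min over δ ∈ {0,1}ⁿ of E‖x − Wᵀ D_δ W (x + ε)‖² = Σ_{i=1}^n min( (Wx)_i², σ² ). -/
open MeasureTheory ProbabilityTheory Matrix Finset NNReal

lemma aux_memLp (n : ℕ) (v : ℝ≥0) (w : Fin n → ℝ) (j : Fin n) :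
    MemLp (fun ε : Fin n → ℝ => w j * ε j) 2
      (Measure.pi fun _ : Fin n => gaussianReal 0 v) := by
  have h : MemLp (id : ℝ → ℝ) 2 (gaussianReal 0 v) := memLp_id_gaussianReal' 2 (by simp)
  exact (h.comp_measurePreserving
    (measurePreserving_eval (fun _ : Fin n => gaussianReal 0 v) j)).const_mul (w j)

lemma aux_memLp_sub (n : ℕ) (v : ℝ≥0) (w : Fin n → ℝ) (a : ℝ) :
    MemLp (fun ε : Fin n → ℝ => a - ∑ j, w j * ε j) 2
      (Measure.pi fun _ : Fin n => gaussianReal 0 v) :=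
  (memLp_const a).sub (memLp_finsetSum _ fun j _ => aux_memLp n v w j)

lemma aux_mean (n : ℕ) (v : ℝ≥0) (w : Fin n → ℝ) :
    ∫ ε : Fin n → ℝ, ∑ j, w j * ε j ∂(Measure.pi fun _ : Fin n => gaussianReal 0 v) = 0 := by
  rw [integral_finsetSum _ fun j _ => (aux_memLp n v w j).integrable (by norm_num)]
  refine Finset.sum_eq_zero fun j _ => ?_
  rw [integral_const_mul]
  have h := integral_comp_eval (μ := fun _ : Fin n => gaussianReal 0 v) (i := j)
    (f := fun y : ℝ => y) (by fun_prop)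
  rw [h, integral_id_gaussianReal, mul_zero]

lemma aux_sq (n : ℕ) (v : ℝ≥0) (w : Fin n → ℝ) (a : ℝ) :
    ∫ ε : Fin n → ℝ, (a - ∑ j, w j * ε j) ^ 2
      ∂(Measure.pi fun _ : Fin n => gaussianReal 0 v) = a ^ 2 + v * ∑ j, w j ^ 2 := by
  have hS : MemLp (fun ε : Fin n → ℝ => ∑ j, w j * ε j) 2
      (Measure.pi fun _ : Fin n => gaussianReal 0 v) :=
    memLp_finsetSum _ fun j _ => aux_memLp n v w j
  have h1 := variance_eq_sub (aux_memLp_sub n v w a)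
  rw [variance_const_sub hS.aestronglyMeasurable] at h1
  have h2 := variance_sum_pi (μ := fun _ : Fin n => gaussianReal 0 v)
    (X := fun j y => w j * y)
    (fun j => (memLp_id_gaussianReal' 2 (by simp)).const_mul (w j))
  have h3 : (∑ j, fun ε : Fin n → ℝ => w j * ε j) = fun ε => ∑ j, w j * ε j := by
    ext ε; simp
  rw [h3, h1, integral_sub (integrable_const _) (hS.integrable (by norm_num)), aux_mean] at h2
  have h4 : ∀ j, Var[fun y : ℝ => w j * y; gaussianReal 0 v] = w j ^ 2 * v := fun j => by
    rw [variance_const_mul (w j) (fun y : ℝ => y), variance_fun_id_gaussianReal]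
  simp only [h4, Pi.pow_apply,
    integral_const, probReal_univ, one_smul, sub_zero] at h2
  rw [← Finset.sum_mul] at h2
  linarith

lemma aux_risk (n : ℕ) (W : Matrix (Fin n) (Fin n) ℝ) (hW : Wᵀ * W = 1)
    (x : Fin n → ℝ) (v : ℝ≥0) (δ : Fin n → ℝ) :
    ∫ ε : Fin n → ℝ,
            ‖(EuclideanSpace.equiv (Fin n) ℝ).symm
                (x - Wᵀ.mulVec ((Matrix.diagonal δ).mulVec (W.mulVec (x + ε))))‖ ^ 2
            ∂(Measure.pi fun _ : Fin n => gaussianReal 0 v)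
    = ∑ i, (((1 - δ i) * W.mulVec x i) ^ 2 + v * δ i ^ 2) := by
  have hW' : W * Wᵀ = 1 := mul_eq_one_comm.mp hW
  have key : ∀ ε : Fin n → ℝ, ‖(EuclideanSpace.equiv (Fin n) ℝ).symm
      (x - Wᵀ.mulVec ((Matrix.diagonal δ).mulVec (W.mulVec (x + ε))))‖ ^ 2
      = ∑ i, ((1 - δ i) * W.mulVec x i - ∑ j, (δ i * W i j) * ε j) ^ 2 := by
    intro ε
    set u : Fin n → ℝ := W.mulVec x - (Matrix.diagonal δ).mulVec (W.mulVec (x + ε)) with hu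
    have e1 : x - Wᵀ.mulVec ((Matrix.diagonal δ).mulVec (W.mulVec (x + ε))) = Wᵀ.mulVec u := by
      rw [hu, Matrix.mulVec_sub, Matrix.mulVec_mulVec x, hW, Matrix.one_mulVec]
    have e2 : (Wᵀ.mulVec u) ⬝ᵥ (Wᵀ.mulVec u) = u ⬝ᵥ u := by
      rw [Matrix.dotProduct_mulVec, Matrix.vecMul_transpose, Matrix.mulVec_mulVec, hW',
        Matrix.one_mulVec]
    rw [e1, EuclideanSpace.norm_sq_eq]
    calc _ = (Wᵀ.mulVec u) ⬝ᵥ (Wᵀ.mulVec u) := by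
          simp [dotProduct, sq]
      _ = u ⬝ᵥ u := e2
      _ = _ := by
          refine Finset.sum_congr rfl fun i _ => ?_
          have : u i = (1 - δ i) * W.mulVec x i - ∑ j, (δ i * W i j) * ε j := by
            simp only [hu, Pi.sub_apply, Matrix.mulVec_diagonal, Matrix.mulVec_add, Pi.add_apply]
            simp only [mul_assoc, ← Finset.mul_sum]
            change _ = _ - δ i * (W.mulVec ε i)
            ring
          rw [this, sq]
  simp_rw [key]
  rw [integral_finsetSum _ fun i _ => (aux_memLp_sub n v (fun j => δ i * W i j) _).integrable_sq]
  refine Finset.sum_congr rfl fun i _ => ?_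
  rw [aux_sq n v (fun j => δ i * W i j)]
  have h := congrFun (congrFun hW' i) i
  simp only [Matrix.mul_apply, Matrix.transpose_apply, Matrix.one_apply_eq] at h
  simp only [mul_pow, ← Finset.mul_sum]
  simp only [sq (W i _), h, mul_one]

/-- For an orthogonal `W` (`Wᵀ * W = 1`), the orthogonal ideal risk
`min_{δ ∈ {0,1}ⁿ} E‖x − Wᵀ D_δ W (x + ε)‖²` equals `∑ i, min((Wx)_i², σ²)`.
The minimum (a least element, hence attained) is expressed via `IsLeast`. -/
theorem overcomplete_paper_stmt1
    (n : ℕ) (W : Matrix (Fin n) (Fin n) ℝ) (hW : Wᵀ * W = 1)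
    (x : Fin n → ℝ) (σ : ℝ≥0) (hσ : 0 < σ) :
    IsLeast
      {r : ℝ | ∃ δ : Fin n → ℝ, (∀ i, δ i = 0 ∨ δ i = 1) ∧
        r = ∫ ε : Fin n → ℝ,
            ‖(EuclideanSpace.equiv (Fin n) ℝ).symm
                (x - Wᵀ.mulVec ((Matrix.diagonal δ).mulVec (W.mulVec (x + ε))))‖ ^ 2
            ∂(Measure.pi fun _ : Fin n => gaussianReal 0 (σ ^ 2))}
      (∑ i, min ((W.mulVec x i) ^ 2) ((σ : ℝ) ^ 2)) := by
  constructor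
  · refine ⟨fun i => if (W.mulVec x i) ^ 2 ≤ (σ : ℝ) ^ 2 then 0 else 1, fun i => ?_, ?_⟩
    · by_cases h : (W.mulVec x i) ^ 2 ≤ (σ : ℝ) ^ 2 <;> simp [h]
    · rw [aux_risk n W hW]
      refine Finset.sum_congr rfl fun i _ => ?_
      by_cases h : (W.mulVec x i) ^ 2 ≤ (σ : ℝ) ^ 2
      · simp [h]
      · simp [h, (not_le.mp h).le]
  · rintro r ⟨δ, hδ, rfl⟩
    rw [aux_risk n W hW]
    refine Finset.sum_le_sum fun i _ => ?_
    rcases hδ i with h | h <;> simp [h]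
end

section
/- Let W be a real m×n matrix whose i-th row is ψ_i ∈ ℝⁿ, let M be a real n×m matrix with M·W = I_n whose j-th column is ψ†_j ∈ ℝⁿ, let x ∈ ℝⁿ with μ_i(x) = ⟨ψ_i, x⟩ = (Wx)_i, and let δ ∈ {0,1}^m with D_δ the m×m diagonal matrix with diagonal entries δ. Let ε be a random vector in ℝⁿ with independent coordinates each distributed N(0,σ²), σ > 0. Then the mean-square reconstruction error of the overcomplete thresholding estimator x̂ = M D_δ W (x + ε) satisfies E‖x − M D_δ W (x + ε)‖² = Σ_{i=1}^m Σ_{j=1}^m μ_i(x) μ_j(x) (1−δ_i)(1−δ_j) ⟨ψ†_i, ψ†_j⟩ + σ² Σ_{i=1}^m Σ_{j=1}^m δ_i δ_j ⟨ψ†_i, ψ†_j⟩ ⟨ψ_i, ψ_j⟩. -/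
open MeasureTheory ProbabilityTheory Matrix Finset NNReal

lemma aux_int (n : ℕ) (v : ℝ≥0) (b : ℝ) (a : Fin n → ℝ) :
    Integrable (fun ε : Fin n → ℝ => (b - ∑ l, a l * ε l) ^ 2)
      (Measure.pi fun _ : Fin n => gaussianReal 0 v) ∧
    ∫ ε : Fin n → ℝ, (b - ∑ l, a l * ε l) ^ 2 ∂(Measure.pi fun _ : Fin n => gaussianReal 0 v)
      = b ^ 2 + v * ∑ l, a l ^ 2 := by
  set P := Measure.pi fun _ : Fin n => gaussianReal 0 v with hP
  have hg : ∀ c : ℝ, MemLp (fun t : ℝ => c * t) 2 (gaussianReal 0 v) := fun c =>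
    (memLp_id_gaussianReal (μ := 0) (v := v) 2).const_mul c
  have hev : ∀ l : Fin n, MeasurePreserving (Function.eval l) P (gaussianReal 0 v) := fun l =>
    measurePreserving_eval (fun _ : Fin n => gaussianReal 0 v) l
  have hl : ∀ l : Fin n, MemLp (fun ε : Fin n → ℝ => a l * ε l) 2 P := fun l =>
    (hg (a l)).comp_measurePreserving (hev l)
  have hS : MemLp (fun ε : Fin n → ℝ => ∑ l, a l * ε l) 2 P :=
    memLp_finsetSum _ fun l _ => hl l
  have hT : MemLp (fun ε : Fin n → ℝ => b - ∑ l, a l * ε l) 2 P := (memLp_const b).sub hS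
  refine ⟨hT.integrable_sq, ?_⟩
  have hmean : ∫ ε : Fin n → ℝ, ∑ l, a l * ε l ∂P = 0 := by
    rw [integral_finsetSum _ fun l _ => (hl l).integrable (by norm_num)]
    refine Finset.sum_eq_zero fun l _ => ?_
    rw [integral_const_mul, hP, integral_comp_eval (μ := fun _ : Fin n => gaussianReal 0 v) (i := l) (f := fun t : ℝ => t) (by fun_prop)]
    simp
  have hvar : Var[fun ε : Fin n → ℝ => ∑ l, a l * ε l; P] = v * ∑ l, a l ^ 2 := by
    have h := variance_sum_pi (μ := fun _ : Fin n => gaussianReal 0 v)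
      (X := fun l t => a l * t) (fun l => hg (a l))
    have e : (fun ε : Fin n → ℝ => ∑ l, a l * ε l) = ∑ l, fun ε : Fin n → ℝ => a l * ε l := by
      ext; simp
    rw [e, hP, h, Finset.mul_sum]
    refine Finset.sum_congr rfl fun l _ => ?_
    rw [variance_const_mul, variance_fun_id_gaussianReal]
    ring
  have h1 := variance_eq_sub hT
  rw [variance_const_sub hS.aestronglyMeasurable, hvar, integral_sub (integrable_const b) (hS.integrable (by norm_num)), hmean] at h1
  simp at h1
  linarith

/-- For an analysis operator `W` (rows `ψ_i`), a left inverse `M` (columns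
`ψ†_j`, `M * W = 1`), coefficients `μ_i(x) = ⟨ψ_i, x⟩ = (Wx)_i`, a selection pattern
`δ ∈ {0,1}^m`, and i.i.d. `N(0,σ²)` noise `ε`, the mean-square error of the
overcomplete thresholding estimator `x̂ = M D_δ W (x + ε)` equals
`∑_i ∑_j μ_i(x) μ_j(x) (1−δ_i)(1−δ_j) ⟨ψ†_i, ψ†_j⟩
  + σ² ∑_i ∑_j δ_i δ_j ⟨ψ†_i, ψ†_j⟩ ⟨ψ_i, ψ_j⟩`. -/
theorem overcomplete_paper_stmt5
    (m n : ℕ) (W : Matrix (Fin m) (Fin n) ℝ) (M : Matrix (Fin n) (Fin m) ℝ)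
    (hMW : M * W = 1)
    (x : Fin n → ℝ)
    (δ : Fin m → ℝ) (hδ : ∀ i, δ i = 0 ∨ δ i = 1)
    (σ : ℝ≥0) (hσ : 0 < σ) :
    (∫ ε : Fin n → ℝ,
        ‖(EuclideanSpace.equiv (Fin n) ℝ).symm
            (x - M.mulVec ((Matrix.diagonal δ).mulVec (W.mulVec (x + ε))))‖ ^ 2
        ∂(Measure.pi fun _ : Fin n => gaussianReal 0 (σ ^ 2)))
      = (∑ i, ∑ j, (W.mulVec x i) * (W.mulVec x j) * (1 - δ i) * (1 - δ j)
            * (∑ k, M k i * M k j))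
        + (σ : ℝ) ^ 2 * ∑ i, ∑ j, δ i * δ j
            * (∑ k, M k i * M k j) * (∑ k, W i k * W j k) := by
  have hres : ∀ ε : Fin n → ℝ, ∀ k,
      (x - M.mulVec ((Matrix.diagonal δ).mulVec (W.mulVec (x + ε)))) k
      = (∑ i, M k i * ((1 - δ i) * W.mulVec x i)) - ∑ l, (∑ i, M k i * (δ i * W i l)) * ε l := by
    intro ε k
    have hx : x k = ∑ i, M k i * W.mulVec x i := by
      have : (M.mulVec (W.mulVec x)) k = x k := by
        rw [Matrix.mulVec_mulVec, hMW, Matrix.one_mulVec]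
      rw [← this]; rfl
    have h2 : ∑ l, (∑ i, M k i * (δ i * W i l)) * ε l = ∑ i, M k i * (δ i * W.mulVec ε i) := by
      simp only [Matrix.mulVec, dotProduct, Finset.sum_mul, Finset.mul_sum]
      rw [Finset.sum_comm]
      simp only [mul_assoc]
    have h3 : (M.mulVec ((Matrix.diagonal δ).mulVec (W.mulVec (x + ε)))) k
        = ∑ i, M k i * (δ i * (W.mulVec x i + W.mulVec ε i)) := by
      rw [Matrix.mulVec_add]
      show ∑ i, M k i * _ = _
      simp only [Matrix.mulVec_diagonal, Pi.add_apply]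
    rw [Pi.sub_apply, h3, hx, h2, ← Finset.sum_sub_distrib, ← Finset.sum_sub_distrib]
    exact Finset.sum_congr rfl fun i _ => by ring
  have hn : ∀ ε : Fin n → ℝ, ‖(EuclideanSpace.equiv (Fin n) ℝ).symm
            (x - M.mulVec ((Matrix.diagonal δ).mulVec (W.mulVec (x + ε))))‖ ^ 2
      = ∑ k, ((∑ i, M k i * ((1 - δ i) * W.mulVec x i))
          - ∑ l, (∑ i, M k i * (δ i * W i l)) * ε l) ^ 2 := by
    intro ε
    rw [EuclideanSpace.real_norm_sq_eq]
    exact Finset.sum_congr rfl fun k _ => by rw [← hres ε k]; rfl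
  simp_rw [hn]
  rw [integral_finsetSum _ fun k _ => (aux_int n (σ ^ 2) _ _).1]
  simp_rw [fun k => (aux_int n (σ ^ 2) (∑ i, M k i * ((1 - δ i) * W.mulVec x i))
    (fun l => ∑ i, M k i * (δ i * W i l))).2]
  rw [Finset.sum_add_distrib, ← Finset.mul_sum]
  push_cast
  congr 1
  · simp only [sq, Finset.sum_mul_sum]
    rw [Finset.sum_comm]
    refine Finset.sum_congr rfl fun i _ => ?_
    rw [Finset.sum_comm]
    refine Finset.sum_congr rfl fun j _ => ?_
    rw [Finset.mul_sum]
    exact Finset.sum_congr rfl fun k _ => by ring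
  · congr 1
    have e : ∀ k, ∑ l, (∑ i, M k i * (δ i * W i l)) ^ 2
        = ∑ i, ∑ j, ∑ l, M k i * (δ i * W i l) * (M k j * (δ j * W j l)) := by
      intro k
      simp only [sq, Finset.sum_mul_sum]
      rw [Finset.sum_comm]
      exact Finset.sum_congr rfl fun i _ => Finset.sum_comm
    simp_rw [e]
    rw [Finset.sum_comm]
    refine Finset.sum_congr rfl fun i _ => ?_
    rw [Finset.sum_comm]
    refine Finset.sum_congr rfl fun j _ => ?_
    rw [mul_assoc, Finset.sum_mul_sum, Finset.mul_sum]
    refine Finset.sum_congr rfl fun k _ => ?_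
    rw [Finset.mul_sum]
    exact Finset.sum_congr rfl fun l _ => by ring
end

section
/- Let a, b : {1,…,m} × {1,…,m} → ℝ be such that a_{ij} ≥ 0 and b_{ij} ≥ 0 for all i, j. Then min over δ ∈ {0,1}^m of Σ_{i=1}^m Σ_{j=1}^m [ (1−δ_i)(1−δ_j) a_{ij} + δ_i δ_j b_{ij} ] ≤ Σ_{k=1}^m min( Σ_{j=1}^m a_{kj}, Σ_{j=1}^m b_{kj} ). -/
open Finset

/-- Abstract min-max inequality. For nonnegative coefficients `a`, `b`,
the minimum over selection patterns `δ ∈ {0,1}^m` of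
`∑_i ∑_j ((1−δ_i)(1−δ_j) a_{ij} + δ_i δ_j b_{ij})` is bounded above by
`∑_k min(∑_j a_{kj}, ∑_j b_{kj})`. -/
theorem overcomplete_paper_stmt6
    (m : ℕ) (a b : Fin m → Fin m → ℝ)
    (ha : ∀ i j, 0 ≤ a i j) (hb : ∀ i j, 0 ≤ b i j) :
    sInf {r : ℝ | ∃ δ : Fin m → ℝ, (∀ i, δ i = 0 ∨ δ i = 1) ∧
        r = ∑ i, ∑ j, ((1 - δ i) * (1 - δ j) * a i j + δ i * δ j * b i j)}
      ≤ ∑ k, min (∑ j, a k j) (∑ j, b k j) := by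
  classical
  let d : Fin m → ℝ := fun i => if ∑ j, a i j ≤ ∑ j, b i j then 0 else 1
  have hd : ∀ i, d i = 0 ∨ d i = 1 := by
    intro i
    by_cases h : ∑ j, a i j ≤ ∑ j, b i j
    · left; simp [d, h]
    · right; simp only [d, if_neg h]
  refine le_trans (csInf_le ?_ ⟨d, hd, rfl⟩) ?_
  · refine ⟨0, ?_⟩
    rintro r ⟨δ, hδ, rfl⟩
    refine Finset.sum_nonneg fun i _ => Finset.sum_nonneg fun j _ => ?_
    have h1 := ha i j
    have h2 := hb i j
    rcases hδ i with h | h <;> rcases hδ j with h' | h' <;> simp [h, h', h1, h2]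
  · refine Finset.sum_le_sum fun i _ => ?_
    by_cases h : ∑ j, a i j ≤ ∑ j, b i j
    · have hi : d i = 0 := by simp only [d, if_pos h]
      rw [min_eq_left h]
      refine Finset.sum_le_sum fun j _ => ?_
      have h1 := ha i j
      rcases hd j with h' | h' <;> rw [hi, h'] <;> linarith
    · have hi : d i = 1 := by simp only [d, if_neg h]
      rw [min_eq_right (not_le.mp h).le]
      refine Finset.sum_le_sum fun j _ => ?_
      have h1 := hb i j
      rcases hd j with h' | h' <;> rw [hi, h'] <;> linarith
end

section
/- (Proposition 3, expectation form.) Let W be a real m×n matrix whose i-th row is ψ_i ∈ ℝⁿ, let M be a real n×m matrix with M·W = I_n whose j-th column is ψ†_j ∈ ℝⁿ, let x ∈ ℝⁿ with μ_i(z) = ⟨ψ_i, z⟩, and let ε be a random vector in ℝⁿ with independent coordinates each distributed N(0,σ²), σ > 0; set y = x + ε. Then, in the case where no coefficient is selected (D^U = I), the expected empirical risk is controlled by the ideal term plus a redundancy penalty: E[ Σ_{k=1}^m Σ_{j=1}^m |μ_k(y) μ_j(y)| · |⟨ψ†_k, ψ†_j⟩| ] ≤ Σ_{k=1}^m Σ_{j=1}^m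 |μ_k(x) μ_j(x)| · |⟨ψ†_k, ψ†_j⟩| + Σ_{k=1}^m Σ_{j=1}^m C[k,j] · |⟨ψ†_k, ψ†_j⟩|, where C[k,j] = |μ_k(x)| · ‖ψ_j‖₁ · σ · √(2/π) + |μ_j(x)| · ‖ψ_k‖₁ · σ · √(2/π) + σ² · ‖ψ_k‖₁ · ‖ψ_j‖₁. -/
open MeasureTheory ProbabilityTheory Matrix Finset NNReal

lemma aux_abs (σ : ℝ≥0) (hσ : 0 < σ) :
    ∫ t, |t| ∂(gaussianReal 0 (σ ^ 2)) = (σ : ℝ) * Real.sqrt (2 / Real.pi) := by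
  have hs : (0:ℝ) < σ := by exact_mod_cast hσ
  rw [integral_gaussianReal_eq_integral_smul (by positivity)]
  have h1 : ∀ t : ℝ, gaussianPDFReal 0 (σ ^ 2) t • |t| =
      (fun u : ℝ => (Real.sqrt (2 * Real.pi * (σ:ℝ) ^ 2))⁻¹ *
        (u ^ (1:ℝ) * Real.exp (-(1 / (2 * (σ:ℝ) ^ 2)) * u ^ (2:ℝ)))) |t| := by
    intro t
    simp only [gaussianPDFReal, smul_eq_mul, Real.rpow_one, Real.rpow_two, sq_abs, sub_zero]
    push_cast
    rw [show -t ^ 2 / (2 * (σ:ℝ) ^ 2) = -(1 / (2 * (σ:ℝ) ^ 2)) * t ^ 2 by ring]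
    ring
  simp_rw [h1]
  rw [integral_comp_abs (f := fun u : ℝ => (Real.sqrt (2 * Real.pi * (σ:ℝ) ^ 2))⁻¹ *
        (u ^ (1:ℝ) * Real.exp (-(1 / (2 * (σ:ℝ) ^ 2)) * u ^ (2:ℝ)))), integral_const_mul,
    integral_rpow_mul_exp_neg_mul_rpow (by norm_num) (by norm_num) (by positivity)]
  norm_num
  rw [Real.rpow_neg_one]
  have hp := Real.pi_pos
  have h2 : Real.sqrt 2 ^ 2 = 2 := Real.sq_sqrt (by norm_num)
  field_simp
  try nlinarith [h2]

lemma aux_sq_s12 (σ : ℝ≥0) : ∫ t, t ^ 2 ∂(gaussianReal 0 (σ ^ 2)) = (σ : ℝ) ^ 2 := by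
  have h := variance_fun_id_gaussianReal (μ := 0) (v := σ ^ 2)
  rw [variance_of_integral_eq_zero (by fun_prop) (by simp)] at h
  simpa using h

lemma aux_int_sq (σ : ℝ≥0) : Integrable (fun t : ℝ => t ^ 2) (gaussianReal 0 (σ ^ 2)) :=
  (memLp_id_gaussianReal (μ := 0) (v := σ ^ 2) 2).integrable_sq

lemma aux_int_abs (σ : ℝ≥0) : Integrable (fun t : ℝ => |t|) (gaussianReal 0 (σ ^ 2)) := by
  have h := (memLp_id_gaussianReal (μ := 0) (v := σ ^ 2) 1)
  exact (memLp_one_iff_integrable.mp (show MemLp (id : ℝ → ℝ) 1 _ by simpa using h)).abs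

section
variable {n : ℕ} (σ : ℝ≥0)

lemma aux_pi (f : ℝ → ℝ) (hf : Integrable f (gaussianReal 0 (σ ^ 2))) (i : Fin n) :
    Integrable (fun e : Fin n → ℝ => f (e i)) (Measure.pi fun _ : Fin n => gaussianReal 0 (σ ^ 2))
    ∧ ∫ e : Fin n → ℝ, f (e i) ∂(Measure.pi fun _ : Fin n => gaussianReal 0 (σ ^ 2))
      = ∫ t, f t ∂(gaussianReal 0 (σ ^ 2)) := by
  have hp := measurePreserving_eval (fun _ : Fin n => gaussianReal 0 (σ ^ 2)) i
  refine ⟨hp.integrable_comp_of_integrable hf, ?_⟩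
  have := integral_map (μ := Measure.pi fun _ : Fin n => gaussianReal 0 (σ ^ 2))
    hp.measurable.aemeasurable (f := f) (by rw [hp.map_eq]; exact hf.1)
  rw [hp.map_eq] at this
  exact this.symm

lemma aux_S (hσ : 0 < σ) (a : Fin n → ℝ) :
    Integrable (fun e : Fin n → ℝ => ∑ i, a i * |e i|)
      (Measure.pi fun _ : Fin n => gaussianReal 0 (σ ^ 2))
    ∧ ∫ e : Fin n → ℝ, ∑ i, a i * |e i| ∂(Measure.pi fun _ : Fin n => gaussianReal 0 (σ ^ 2))
      = (∑ i, a i) * ((σ:ℝ) * Real.sqrt (2 / Real.pi)) := by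
  have hi := fun i => aux_pi (n := n) σ _ (aux_int_abs σ) i
  refine ⟨integrable_finsetSum _ fun i _ => (hi i).1.const_mul _, ?_⟩
  rw [integral_finsetSum _ fun i _ => (hi i).1.const_mul _, Finset.sum_mul]
  refine Finset.sum_congr rfl fun i _ => ?_
  rw [integral_const_mul, (hi i).2, aux_abs σ hσ]

lemma aux_T (a b : Fin n → ℝ) :
    Integrable (fun e : Fin n → ℝ => ∑ i, ∑ l, a i * b l * ((e i ^ 2 + e l ^ 2) / 2))
      (Measure.pi fun _ : Fin n => gaussianReal 0 (σ ^ 2))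
    ∧ ∫ e : Fin n → ℝ, ∑ i, ∑ l, a i * b l * ((e i ^ 2 + e l ^ 2) / 2)
        ∂(Measure.pi fun _ : Fin n => gaussianReal 0 (σ ^ 2))
      = (σ:ℝ) ^ 2 * (∑ i, a i) * (∑ i, b i) := by
  have hi := fun i => aux_pi (n := n) σ _ (aux_int_sq σ) i
  have h2 : ∀ i l, Integrable (fun e : Fin n → ℝ => a i * b l * ((e i ^ 2 + e l ^ 2) / 2))
      (Measure.pi fun _ : Fin n => gaussianReal 0 (σ ^ 2)) := fun i l =>
    (((hi i).1.add (hi l).1).div_const 2).const_mul _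
  have h3 : ∀ i, Integrable (fun e : Fin n → ℝ => ∑ l, a i * b l * ((e i ^ 2 + e l ^ 2) / 2))
      (Measure.pi fun _ : Fin n => gaussianReal 0 (σ ^ 2)) := fun i =>
    integrable_finsetSum _ fun l _ => h2 i l
  refine ⟨integrable_finsetSum _ fun i _ => h3 i, ?_⟩
  rw [integral_finsetSum _ fun i _ => h3 i, mul_assoc, Finset.sum_mul_sum, Finset.mul_sum]
  refine Finset.sum_congr rfl fun i _ => ?_
  rw [integral_finsetSum _ fun l _ => h2 i l, Finset.mul_sum]
  refine Finset.sum_congr rfl fun l _ => ?_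
  rw [integral_const_mul, integral_div, integral_add (hi i).1 (hi l).1, (hi i).2, (hi l).2,
    aux_sq_s12]
  ring

lemma aux_pt (w v x e : Fin n → ℝ) :
    |(w ⬝ᵥ (x + e)) * (v ⬝ᵥ (x + e))| ≤ |(w ⬝ᵥ x) * (v ⬝ᵥ x)|
      + |w ⬝ᵥ x| * (∑ i, |v i| * |e i|) + |v ⬝ᵥ x| * (∑ i, |w i| * |e i|)
      + ∑ i, ∑ l, |w i| * |v l| * ((e i ^ 2 + e l ^ 2) / 2) := by
  have hb : ∀ w : Fin n → ℝ, |w ⬝ᵥ e| ≤ ∑ i, |w i| * |e i| := fun w => by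
    simp_rw [← abs_mul]
    exact Finset.abs_sum_le_sum_abs _ _
  have hT : (∑ i, |w i| * |e i|) * (∑ i, |v i| * |e i|)
      ≤ ∑ i, ∑ l, |w i| * |v l| * ((e i ^ 2 + e l ^ 2) / 2) := by
    rw [Finset.sum_mul_sum]
    refine Finset.sum_le_sum fun i _ => Finset.sum_le_sum fun l _ => ?_
    rw [show |w i| * |e i| * (|v l| * |e l|) = |w i| * |v l| * (|e i| * |e l|) by ring]
    gcongr
    nlinarith [sq_nonneg (|e i| - |e l|), sq_abs (e i), sq_abs (e l)]
  rw [dotProduct_add, dotProduct_add, abs_mul, abs_mul]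
  have h1 := (abs_add_le (w ⬝ᵥ x) (w ⬝ᵥ e)).trans (add_le_add_right (hb w) _)
  have h2 := (abs_add_le (v ⬝ᵥ x) (v ⬝ᵥ e)).trans (add_le_add_right (hb v) _)
  have h3 := mul_le_mul h1 h2 (abs_nonneg _) ((abs_nonneg _).trans h1)
  linarith

lemma aux_G (hσ : 0 < σ) (w v x : Fin n → ℝ) :
    Integrable (fun e : Fin n → ℝ => |(w ⬝ᵥ x) * (v ⬝ᵥ x)|
      + |w ⬝ᵥ x| * (∑ i, |v i| * |e i|) + |v ⬝ᵥ x| * (∑ i, |w i| * |e i|)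
      + ∑ i, ∑ l, |w i| * |v l| * ((e i ^ 2 + e l ^ 2) / 2))
      (Measure.pi fun _ : Fin n => gaussianReal 0 (σ ^ 2))
    ∧ ∫ e : Fin n → ℝ, (|(w ⬝ᵥ x) * (v ⬝ᵥ x)|
      + |w ⬝ᵥ x| * (∑ i, |v i| * |e i|) + |v ⬝ᵥ x| * (∑ i, |w i| * |e i|)
      + ∑ i, ∑ l, |w i| * |v l| * ((e i ^ 2 + e l ^ 2) / 2))
        ∂(Measure.pi fun _ : Fin n => gaussianReal 0 (σ ^ 2))
      = |(w ⬝ᵥ x) * (v ⬝ᵥ x)| +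
        (|w ⬝ᵥ x| * (∑ i, |v i|) * (σ : ℝ) * Real.sqrt (2 / Real.pi)
              + |v ⬝ᵥ x| * (∑ i, |w i|) * (σ : ℝ) * Real.sqrt (2 / Real.pi)
              + (σ : ℝ) ^ 2 * (∑ i, |w i|) * (∑ i, |v i|)) := by
  have hv := aux_S σ hσ (fun i => |v i|)
  have hw := aux_S σ hσ (fun i => |w i|)
  have hT := aux_T σ (fun i => |w i|) (fun i => |v i|)
  have i1 := integrable_const (μ := Measure.pi fun _ : Fin n => gaussianReal 0 (σ ^ 2))
    (|(w ⬝ᵥ x) * (v ⬝ᵥ x)|)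
  have i2 := hv.1.const_mul (|w ⬝ᵥ x|)
  have i3 := hw.1.const_mul (|v ⬝ᵥ x|)
  refine ⟨((i1.add i2).add i3).add hT.1, ?_⟩
  rw [integral_add ((i1.fun_add i2).fun_add i3) hT.1, integral_add (i1.fun_add i2) i3, integral_add i1 i2,
    integral_const_mul, integral_const_mul, hv.2, hw.2, hT.2]
  simp
  ring
end


/-- Proposition 3, expectation form: With `ψ_k` the rows of `W`, `ψ†_j`
the columns of a left inverse `M` (`M * W = 1`), `μ_k(z) = ⟨ψ_k, z⟩`, `y = x + ε` for
i.i.d. `N(0,σ²)` noise `ε`, the expected empirical risk in the unselected branch is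
controlled by the ideal term plus a redundancy penalty:
`E[∑_k ∑_j |μ_k(y) μ_j(y)| |⟨ψ†_k, ψ†_j⟩|]
   ≤ ∑_k ∑_j |μ_k(x) μ_j(x)| |⟨ψ†_k, ψ†_j⟩| + ∑_k ∑_j C[k,j] |⟨ψ†_k, ψ†_j⟩|`
with `C[k,j] = |μ_k(x)| ‖ψ_j‖₁ σ √(2/π) + |μ_j(x)| ‖ψ_k‖₁ σ √(2/π) + σ² ‖ψ_k‖₁ ‖ψ_j‖₁`. -/
theorem overcomplete_paper_stmt12
    (m n : ℕ) (W : Matrix (Fin m) (Fin n) ℝ) (M : Matrix (Fin n) (Fin m) ℝ)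
    (hMW : M * W = 1)
    (x : Fin n → ℝ) (σ : ℝ≥0) (hσ : 0 < σ) :
    (∫ ε : Fin n → ℝ,
        ∑ k, ∑ j, |(W.mulVec (x + ε) k) * (W.mulVec (x + ε) j)|
          * |∑ i, M i k * M i j|
        ∂(Measure.pi fun _ : Fin n => gaussianReal 0 (σ ^ 2)))
      ≤ (∑ k, ∑ j, |(W.mulVec x k) * (W.mulVec x j)| * |∑ i, M i k * M i j|)
        + ∑ k, ∑ j,
            (|W.mulVec x k| * (∑ i, |W j i|) * (σ : ℝ) * Real.sqrt (2 / Real.pi)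
              + |W.mulVec x j| * (∑ i, |W k i|) * (σ : ℝ) * Real.sqrt (2 / Real.pi)
              + (σ : ℝ) ^ 2 * (∑ i, |W k i|) * (∑ i, |W j i|))
            * |∑ i, M i k * M i j| := by

  have hG := fun k j => aux_G σ hσ (W k) (W j) x
  have h2 := fun k j => (hG k j).1.mul_const (|∑ i, M i k * M i j|)
  have h3 := fun k => integrable_finsetSum Finset.univ fun j _ => h2 k j
  refine (integral_mono_of_nonneg (Filter.Eventually.of_forall fun e => ?_)
    (integrable_finsetSum Finset.univ fun k _ => h3 k)
    (Filter.Eventually.of_forall fun e => ?_)).trans (le_of_eq ?_)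
  · exact Finset.sum_nonneg fun k _ => Finset.sum_nonneg fun j _ => by positivity
  · exact Finset.sum_le_sum fun k _ => Finset.sum_le_sum fun j _ =>
      mul_le_mul_of_nonneg_right (aux_pt (W k) (W j) x e) (abs_nonneg _)
  · rw [integral_finsetSum _ fun k _ => h3 k, ← Finset.sum_add_distrib]
    refine Finset.sum_congr rfl fun k _ => ?_
    rw [integral_finsetSum _ fun j _ => h2 k j, ← Finset.sum_add_distrib]
    refine Finset.sum_congr rfl fun j _ => ?_
    rw [integral_mul_const, (hG k j).2, add_mul]
    rfl
end
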